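/- arXiv:2101.05671 — 2 statements merged into one kernel-verified Lean document; each statement's English description precedes it below -/
import Mathlib

section
/- Ext¹_A(D(A), A) = 0, i.e. every short exact sequence of A-modules 0 → A → E → D(A) → 0 splits. -/
/-!
We formalize statements about the algebra `A = kQ/J²`, where `Q` is the quiver
`1 ⇄ 2 ⇄ 3` and `J` is the arrow ideal of the path algebra `kQ`.
The algebra `A` is presented by generators and relations as a quotient of the
free algebra on three vertex idempotents and four arrows.
Right `A`-modules are treated as left modules over `Aᵐᵒᵖ`.
-/

open CategoryTheory Opposite

/-- Generators of the path algebra `kQ`: three vertex idempotents `e i`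
and four arrows `ar a`, where the arrows of `Q` are
`α : 1 → 2`, `β : 2 → 1`, `γ : 2 → 3`, `δ : 3 → 2`. -/
inductive QGen : Type
  | e : Fin 3 → QGen
  | ar : Fin 4 → QGen

/-- The sources of the four arrows `α, β, γ, δ` (vertices `1,2,3` are `0,1,2 : Fin 3`). -/
def arrowSrc : Fin 4 → Fin 3 := ![0, 1, 1, 2]

/-- The targets of the four arrows `α, β, γ, δ`. -/
def arrowTgt : Fin 4 → Fin 3 := ![1, 0, 2, 1]

/-- The defining relations of `A = kQ/J²`: the `e i` are orthogonal idempotents summing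
to `1`, the arrows are compatible with their sources and targets, and any product of
two arrows vanishes (`J² = 0`). -/
inductive ARel (k : Type) [Field k] : FreeAlgebra k QGen → FreeAlgebra k QGen → Prop
  | idem (i j : Fin 3) :
      ARel k (FreeAlgebra.ι k (QGen.e i) * FreeAlgebra.ι k (QGen.e j))
        (if i = j then FreeAlgebra.ι k (QGen.e i) else 0)
  | sum : ARel k
      (FreeAlgebra.ι k (QGen.e 0) + FreeAlgebra.ι k (QGen.e 1) + FreeAlgebra.ι k (QGen.e 2)) 1
  | src (a : Fin 4) :
      ARel k (FreeAlgebra.ι k (QGen.e (arrowSrc a)) * FreeAlgebra.ι k (QGen.ar a))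
        (FreeAlgebra.ι k (QGen.ar a))
  | tgt (a : Fin 4) :
      ARel k (FreeAlgebra.ι k (QGen.ar a) * FreeAlgebra.ι k (QGen.e (arrowTgt a)))
        (FreeAlgebra.ι k (QGen.ar a))
  | radsq (a b : Fin 4) :
      ARel k (FreeAlgebra.ι k (QGen.ar a) * FreeAlgebra.ι k (QGen.ar b)) 0

/-- The algebra `A = kQ/J²`. -/
abbrev AlgA (k : Type) [Field k] : Type := RingQuot (ARel k)

/-- Right `A`-modules are left modules over `Aop k = Aᵐᵒᵖ`. -/
abbrev Aop (k : Type) [Field k] : Type := (AlgA k)ᵐᵒᵖ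

/-- The algebra homomorphism `A → k` corresponding to the vertex `i`. -/
noncomputable def simpleAlgHom (k : Type) [Field k] (i : Fin 3) : AlgA k →ₐ[k] k :=
  RingQuot.liftAlgHom k
    ⟨FreeAlgebra.lift k (fun g => match g with
        | QGen.e j => if j = i then (1 : k) else 0
        | QGen.ar _ => 0), by
      intro _x _y h
      induction h with
      | idem i j =>
          simp only [map_mul, FreeAlgebra.lift_ι_apply, apply_ite, map_zero]
          split_ifs <;> simp_all
      | sum =>
          simp only [map_add, map_one, FreeAlgebra.lift_ι_apply]
          fin_cases i <;> simp
      | src a => simp [FreeAlgebra.lift_ι_apply]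
      | tgt a => simp [FreeAlgebra.lift_ι_apply]
      | radsq a b => simp [FreeAlgebra.lift_ι_apply]⟩

/-- The ring homomorphism `Aᵐᵒᵖ → k` corresponding to the vertex `i`. -/
noncomputable def simpleRingHom (k : Type) [Field k] (i : Fin 3) : Aop k →+* k :=
  RingHom.fromOpposite (simpleAlgHom k i).toRingHom (fun _ _ => mul_comm _ _)

/-- The simple right `A`-module `S_{i+1}` at the vertex `i` (one-dimensional over `k`,
with `e i` acting as the identity and all arrows acting by zero).
So `SimpleS k 0 = S₁`, `SimpleS k 1 = S₂` and `SimpleS k 2 = S₃`. -/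
def SimpleS (k : Type) [Field k] (_i : Fin 3) : Type := k

instance (k : Type) [Field k] (i : Fin 3) : AddCommGroup (SimpleS k i) :=
  inferInstanceAs (AddCommGroup k)

instance (k : Type) [Field k] (i : Fin 3) : Module k (SimpleS k i) :=
  inferInstanceAs (Module k k)

noncomputable instance (k : Type) [Field k] (i : Fin 3) : Module (Aop k) (SimpleS k i) :=
  Module.compHom (SimpleS k i) (simpleRingHom k i)

/-- The underlying type of `D(A) = Hom_k(A, k)`. -/
abbrev DualA (k : Type) [Field k] : Type := AlgA k →ₗ[k] k

/-- The right `A`-module structure on `D(A)`: `(φ · a) x = φ (a * x)`. -/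
noncomputable instance (k : Type) [Field k] : Module (Aop k) (DualA k) where
  smul a φ := φ.comp (LinearMap.mulLeft k a.unop)
  one_smul φ := by
    show φ.comp (LinearMap.mulLeft k ((1 : Aop k).unop)) = φ
    ext x; simp
  mul_smul a b φ := by
    show φ.comp (LinearMap.mulLeft k ((a * b).unop)) =
      (φ.comp (LinearMap.mulLeft k b.unop)).comp (LinearMap.mulLeft k a.unop)
    ext x; simp [mul_assoc]
  smul_zero a := by
    show (0 : DualA k).comp (LinearMap.mulLeft k a.unop) = 0
    ext x; simp
  smul_add a φ ψ := by
    show (φ + ψ).comp (LinearMap.mulLeft k a.unop) =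
      φ.comp (LinearMap.mulLeft k a.unop) + ψ.comp (LinearMap.mulLeft k a.unop)
    ext x; simp
  add_smul a b φ := by
    show φ.comp (LinearMap.mulLeft k ((a + b).unop)) =
      φ.comp (LinearMap.mulLeft k a.unop) + φ.comp (LinearMap.mulLeft k b.unop)
    ext x; simp [add_mul]
  zero_smul φ := by
    show φ.comp (LinearMap.mulLeft k ((0 : Aop k).unop)) = 0
    ext x; simp

/-- The right `A`-module `M = A ⊕ D(A)`, where `A` carries the right regular
`A`-module structure. -/
abbrev MA (k : Type) [Field k] : Type := AlgA k × DualA k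

/-- `X` belongs to `add M`: `X` is (isomorphic to) a direct summand of `Mⁿ` for some `n`. -/
def InAdd (k : Type) [Field k] (M X : Type) [AddCommGroup M] [Module (Aop k) M]
    [AddCommGroup X] [Module (Aop k) X] : Prop :=
  ∃ (n : ℕ) (ι : X →ₗ[Aop k] (Fin n → M)) (π : (Fin n → M) →ₗ[Aop k] X),
    π.comp ι = LinearMap.id

/-- `Ext^i_A(X, Y)` for right `A`-modules `X` and `Y`, computed in the abelian
category of all right `A`-modules (which has the same `Ext` groups as `mod A`). -/
noncomputable def ExtA (k : Type) [Field k] (X Y : Type) [AddCommGroup X] [Module (Aop k) X]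
    [AddCommGroup Y] [Module (Aop k) Y] (i : ℕ) : Type :=
  ((Ext ℤ (ModuleCat (Aop k)) i).obj (op (ModuleCat.of (Aop k) X))).obj (ModuleCat.of (Aop k) Y)

theorem exists_comp_eq_of_forall_splits {R P₂ P₁ P₀ X Y : Type} [Ring R]
    [AddCommGroup P₂] [Module R P₂] [AddCommGroup P₁] [Module R P₁]
    [AddCommGroup P₀] [Module R P₀] [AddCommGroup X] [Module R X]
    [AddCommGroup Y] [Module R Y]
    (d₂ : P₂ →ₗ[R] P₁) (d₁ : P₁ →ₗ[R] P₀) (π : P₀ →ₗ[R] X)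
    (h₁ : Function.Exact d₂ d₁) (h₀ : Function.Exact d₁ π) (hπ : Function.Surjective π)
    (splits : ∀ (E : Type) [AddCommGroup E] [Module R E] (f : Y →ₗ[R] E) (g : E →ₗ[R] X),
      Function.Injective f → Function.Surjective g → LinearMap.range f = LinearMap.ker g →
      ∃ s : X →ₗ[R] E, g.comp s = LinearMap.id)
    (φ : P₁ →ₗ[R] Y) (hφ : φ.comp d₂ = 0) : ∃ ρ : P₀ →ₗ[R] Y, ρ.comp d₁ = φ := by
  -- The pushout of `φ` and `d₁` is an extension of `X` by `Y`.
  let N : Submodule R (Y × P₀) := LinearMap.range (φ.prod (-d₁))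
  let f : Y →ₗ[R] (Y × P₀) ⧸ N := N.mkQ.comp (LinearMap.inl R Y P₀)
  let g : (Y × P₀) ⧸ N →ₗ[R] X := N.liftQ (π.comp (LinearMap.snd R Y P₀)) (by
    rintro _ ⟨p, rfl⟩
    simp [h₀.apply_apply_eq_zero])
  have hf : Function.Injective f := by
    rw [injective_iff_map_eq_zero]
    intro y hy
    obtain ⟨p, hp⟩ := (Submodule.Quotient.mk_eq_zero N).1 hy
    obtain ⟨q, rfl⟩ := (h₁ p).1 (neg_eq_zero.1 (congrArg Prod.snd hp))
    refine (congrArg Prod.fst hp).symm.trans ?_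
    exact LinearMap.congr_fun hφ q
  have mk_d (p : P₁) : N.mkQ (0, d₁ p) = f (φ p) := by
    refine (Submodule.Quotient.eq N).2 ⟨-p, ?_⟩
    simp
  have hg : Function.Surjective g := fun x ↦ by
    obtain ⟨p, rfl⟩ := hπ x
    exact ⟨N.mkQ (0, p), rfl⟩
  have hfg : LinearMap.range f = LinearMap.ker g := by
    ext z
    constructor
    · rintro ⟨y, rfl⟩
      exact map_zero π
    · obtain ⟨⟨y, p⟩, rfl⟩ := N.mkQ_surjective z
      intro hz
      obtain ⟨q, rfl⟩ := (h₀ p).1 hz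
      refine ⟨y + φ q, ?_⟩
      rw [map_add, ← mk_d]
      change N.mkQ (y, 0) + _ = _
      rw [← map_add]
      simp
  obtain ⟨s, hs⟩ := splits _ f g hf hg hfg
  let t : P₀ →ₗ[R] (Y × P₀) ⧸ N := N.mkQ.comp (LinearMap.inr R Y P₀) - s.comp π
  have ht (p : P₀) : t p ∈ LinearMap.range f := by
    rw [hfg, LinearMap.mem_ker]
    change g (N.mkQ (0, p) - s (π p)) = 0
    rw [map_sub, sub_eq_zero]
    exact (LinearMap.congr_fun hs (π p)).symm
  let ρ : P₀ →ₗ[R] Y :=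
    (LinearEquiv.ofInjective f hf).symm.toLinearMap.comp (t.codRestrict _ ht)
  have hρ (p : P₀) : f (ρ p) = t p :=
    congrArg Subtype.val ((LinearEquiv.ofInjective f hf).apply_symm_apply ⟨t p, ht p⟩)
  refine ⟨ρ, LinearMap.ext fun p ↦ hf ?_⟩
  refine (hρ (d₁ p)).trans (Eq.trans ?_ (mk_d p))
  change N.mkQ (0, d₁ p) - s (π (d₁ p)) = _
  rw [h₀.apply_apply_eq_zero, map_zero, sub_zero]

theorem subsingleton_ext_one_of_forall_splits {R : Type} [Ring R] (X Y : ModuleCat.{0} R)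
    (splits : ∀ (E : Type) [AddCommGroup E] [Module R E] (f : Y →ₗ[R] E) (g : E →ₗ[R] X),
      Function.Injective f → Function.Surjective g → LinearMap.range f = LinearMap.ker g →
      ∃ s : X →ₗ[R] E, g.comp s = LinearMap.id) :
    Subsingleton (((Ext ℤ (ModuleCat.{0} R) 1).obj (op X)).obj Y) := by
  let P := projectiveResolution X
  rw [← ModuleCat.isZero_iff_subsingleton]
  refine Limits.IsZero.of_iso ?_ (P.isoExt 1 Y)
  rw [← HomologicalComplex.exactAt_iff_isZero_homology,
    HomologicalComplex.exactAt_iff' _ 0 1 2 (by simp) (by simp),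
    ShortComplex.moduleCat_exact_iff]
  intro (φ : P.complex.X 1 ⟶ Y) hφ
  replace hφ : P.complex.d 2 1 ≫ φ = 0 := hφ
  obtain ⟨ρ, hρ⟩ := exists_comp_eq_of_forall_splits (P.complex.d 2 1).hom (P.complex.d 1 0).hom
    (P.π.f 0).hom
    ((ShortComplex.ShortExact.moduleCat_exact_iff_function_exact _).1 (P.exact_succ 0))
    ((ShortComplex.ShortExact.moduleCat_exact_iff_function_exact _).1 P.exact₀)
    ((ModuleCat.epi_iff_surjective _).1 inferInstance)
    splits φ.hom (congrArg ModuleCat.Hom.hom hφ)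
  exact ⟨ModuleCat.ofHom ρ, ModuleCat.hom_ext hρ⟩

namespace AlgA

variable (k : Type) [Field k]

/-- The class in `A` of the vertex idempotent `e i`. -/
noncomputable def e (i : Fin 3) : AlgA k :=
  RingQuot.mkAlgHom k (ARel k) (FreeAlgebra.ι k (QGen.e i))

/-- The class in `A` of the arrow `a`. -/
noncomputable def ar (a : Fin 4) : AlgA k :=
  RingQuot.mkAlgHom k (ARel k) (FreeAlgebra.ι k (QGen.ar a))

variable {k}

theorem e_mul_e (i j : Fin 3) : e k i * e k j = if i = j then e k i else 0 := by
  have h := RingQuot.mkAlgHom_rel k (ARel.idem (k := k) i j)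
  rw [map_mul, apply_ite (RingQuot.mkAlgHom k (ARel k)), map_zero] at h
  exact h

theorem sum_e : ∑ i, e k i = 1 := by
  have h := RingQuot.mkAlgHom_rel k (ARel.sum (k := k))
  rw [map_add, map_add, map_one] at h
  rw [Fin.sum_univ_three]
  exact h

theorem e_src_mul_ar (a : Fin 4) : e k (arrowSrc a) * ar k a = ar k a := by
  have h := RingQuot.mkAlgHom_rel k (ARel.src (k := k) a)
  rwa [map_mul] at h

theorem ar_mul_e_tgt (a : Fin 4) : ar k a * e k (arrowTgt a) = ar k a := by
  have h := RingQuot.mkAlgHom_rel k (ARel.tgt (k := k) a)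
  rwa [map_mul] at h

theorem ar_mul_ar (a b : Fin 4) : ar k a * ar k b = 0 := by
  have h := RingQuot.mkAlgHom_rel k (ARel.radsq (k := k) a b)
  rwa [map_mul, map_zero] at h

theorem e_mul_ar (i : Fin 3) (a : Fin 4) :
    e k i * ar k a = if i = arrowSrc a then ar k a else 0 := by
  rw [← e_src_mul_ar, ← mul_assoc, e_mul_e]
  split_ifs with h
  · rw [h]
  · rw [zero_mul]

theorem ar_mul_e (a : Fin 4) (i : Fin 3) :
    ar k a * e k i = if arrowTgt a = i then ar k a else 0 := by
  rw [← ar_mul_e_tgt, mul_assoc, e_mul_e]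
  split_ifs with h
  · rfl
  · rw [mul_zero]

/-- A property closed under the algebra operations holds on all of `A` if it holds for scalars,
vertex idempotents and arrows. -/
theorem induction {motive : AlgA k → Prop} (algebraMap : ∀ c, motive (algebraMap k _ c))
    (e : ∀ i, motive (e k i)) (ar : ∀ a, motive (ar k a))
    (mul : ∀ x y, motive x → motive y → motive (x * y))
    (add : ∀ x y, motive x → motive y → motive (x + y)) (x : AlgA k) : motive x := by
  obtain ⟨x, rfl⟩ := RingQuot.mkAlgHom_surjective k (ARel k) x
  induction x using FreeAlgebra.induction with
  | grade0 c => rw [AlgHom.commutes]; exact algebraMap c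
  | grade1 g => cases g with
    | e i => exact e i
    | ar a => exact ar a
  | mul x y hx hy => rw [map_mul]; exact mul _ _ hx hy
  | add x y hx hy => rw [map_add]; exact add _ _ hx hy

variable (k) in
/-- The two-dimensional representation of `A` supported on the arrow `a`, as an algebra
homomorphism to two-by-two matrices. -/
noncomputable def arrowAlgHom (a : Fin 4) :
    AlgA k →ₐ[k] Matrix (Fin 2) (Fin 2) k :=
  RingQuot.liftAlgHom k
    ⟨FreeAlgebra.lift k (fun g => match g with
        | QGen.e i => !![if i = arrowSrc a then 1 else 0, 0; 0, if i = arrowTgt a then 1 else 0]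
        | QGen.ar b => !![0, if b = a then 1 else 0; 0, 0]), by
      intro _x _y h
      induction h with
      | idem i j =>
          rw [map_mul, FreeAlgebra.lift_ι_apply, FreeAlgebra.lift_ι_apply, Matrix.mul_fin_two]
          by_cases hij : i = j
          · subst hij
            rw [if_pos rfl, FreeAlgebra.lift_ι_apply]
            ext p q
            fin_cases p <;> fin_cases q <;> simp
          · rw [if_neg hij, map_zero]
            ext p q
            fin_cases p <;> fin_cases q <;> simp <;> grind
      | sum =>
          simp only [map_add, map_one, FreeAlgebra.lift_ι_apply]
          fin_cases a <;> simp [arrowSrc, arrowTgt, Matrix.one_fin_two]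
      | src b =>
          simp only [map_mul, FreeAlgebra.lift_ι_apply, Matrix.mul_fin_two]
          ext p q
          fin_cases p <;> fin_cases q <;> simp <;> grind
      | tgt b =>
          simp only [map_mul, FreeAlgebra.lift_ι_apply, Matrix.mul_fin_two]
          ext p q
          fin_cases p <;> fin_cases q <;> simp <;> grind
      | radsq b c =>
          simp only [map_mul, map_zero, FreeAlgebra.lift_ι_apply, Matrix.mul_fin_two]
          ext p q
          fin_cases p <;> fin_cases q <;> simp⟩

variable (k) in
/-- The coordinate functional of the vertex idempotent `e i`. -/
noncomputable def eDual (i : Fin 3) : DualA k :=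
  (simpleAlgHom k i).toLinearMap

variable (k) in
/-- The coordinate functional of the arrow `a`. -/
noncomputable def arDual (a : Fin 4) : DualA k :=
  Matrix.entryLinearMap k k 0 1 ∘ₗ (arrowAlgHom k a).toLinearMap

@[simp] theorem eDual_e (i j : Fin 3) : eDual k i (e k j) = if j = i then 1 else 0 := by
  simp [eDual, e, simpleAlgHom]

@[simp] theorem eDual_ar (i : Fin 3) (a : Fin 4) : eDual k i (ar k a) = 0 := by
  simp [eDual, ar, simpleAlgHom]

@[simp] theorem arDual_e (a : Fin 4) (i : Fin 3) : arDual k a (e k i) = 0 := by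
  simp [arDual, e, arrowAlgHom]

@[simp] theorem arDual_ar (a b : Fin 4) : arDual k a (ar k b) = if b = a then 1 else 0 := by
  simp [arDual, ar, arrowAlgHom]

theorem span_eq_top : Submodule.span k (Set.range (e k) ∪ Set.range (ar k)) = ⊤ := by
  set S := Submodule.span k (Set.range (e k) ∪ Set.range (ar k)) with hS
  have he (i) : e k i ∈ S := Submodule.subset_span (.inl ⟨i, rfl⟩)
  have har (a) : ar k a ∈ S := Submodule.subset_span (.inr ⟨a, rfl⟩)
  have hmul : S * S ≤ S := by
    rw [hS, Submodule.span_mul_span, Submodule.span_le]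
    rintro _ ⟨_, ⟨i, rfl⟩ | ⟨a, rfl⟩, _, ⟨j, rfl⟩ | ⟨b, rfl⟩, rfl⟩
    · change e k i * e k j ∈ S
      rw [e_mul_e]; split_ifs; exacts [he i, zero_mem S]
    · change e k i * ar k b ∈ S
      rw [e_mul_ar]; split_ifs; exacts [har b, zero_mem S]
    · change ar k a * e k j ∈ S
      rw [ar_mul_e]; split_ifs; exacts [har a, zero_mem S]
    · change ar k a * ar k b ∈ S
      rw [ar_mul_ar]; exact zero_mem S
  refine Submodule.eq_top_iff'.2 fun x ↦ ?_
  induction x using AlgA.induction with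
  | algebraMap c =>
    rw [Algebra.algebraMap_eq_smul_one, ← sum_e]
    exact S.smul_mem c (S.sum_mem fun i _ ↦ he i)
  | e i => exact he i
  | ar a => exact har a
  | mul x y hx hy => exact hmul (Submodule.mul_mem_mul hx hy)
  | add x y hx hy => exact S.add_mem hx hy

theorem linearMap_ext {V : Type} [AddCommGroup V] [Module k V] {φ ψ : AlgA k →ₗ[k] V}
    (he : ∀ i, φ (e k i) = ψ (e k i)) (har : ∀ a, φ (ar k a) = ψ (ar k a)) : φ = ψ :=
  LinearMap.ext_on span_eq_top (by rintro _ (⟨i, rfl⟩ | ⟨a, rfl⟩); exacts [he i, har a])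

/-- The expansion of an element of `A` in the basis of vertices and arrows. -/
theorem sum_dual_smul (x : AlgA k) :
    ∑ i, eDual k i x • e k i + ∑ a, arDual k a x • ar k a = x := by
  have h : ∑ i, (eDual k i).smulRight (e k i) + ∑ a, (arDual k a).smulRight (ar k a) =
      (LinearMap.id : AlgA k →ₗ[k] AlgA k) :=
    linearMap_ext (by simp) (by simp)
  simpa using LinearMap.congr_fun h x

theorem op_smul_dual_apply (x y : AlgA k) (φ : DualA k) :
    (MulOpposite.op x • φ : DualA k) y = φ (x * y) :=
  rfl

instance : IsScalarTower k (Aop k) (DualA k) where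
  smul_assoc c x φ := by
    refine LinearMap.ext fun y ↦ ?_
    change φ ((c • x.unop) * y) = c • φ (x.unop * y)
    rw [smul_mul_assoc, map_smul]

theorem op_e_smul_arDual (a : Fin 4) :
    (MulOpposite.op (e k (arrowSrc a)) • arDual k a : DualA k) = arDual k a := by
  refine linearMap_ext (fun i ↦ ?_) fun b ↦ ?_
  · rw [op_smul_dual_apply, e_mul_e]
    split_ifs <;> simp
  · rw [op_smul_dual_apply, e_mul_ar]
    split_ifs with h
    · rfl
    · have : b ≠ a := by rintro rfl; exact h rfl
      simp [this]

theorem op_ar_smul_arDual (a b : Fin 4) :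
    (MulOpposite.op (ar k b) • arDual k a : DualA k) = if b = a then eDual k (arrowTgt a) else 0 := by
  refine linearMap_ext (fun i ↦ ?_) fun c ↦ ?_
  · rw [op_smul_dual_apply, ar_mul_e]
    split_ifs with h₁ h₂ h₂ <;> subst_vars <;> simp_all [eq_comm]
  · rw [op_smul_dual_apply, ar_mul_ar]
    split_ifs <;> simp

theorem exists_arrowSrc_eq (i : Fin 3) : ∃ a, arrowSrc a = i := by
  revert i; decide

theorem exists_arrowTgt_eq (i : Fin 3) : ∃ a, arrowTgt a = i := by
  revert i; decide

/-- An element of `A e i` annihilated by all arrows is a combination of arrows ending in `i`. -/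
theorem eq_sum_arDual_smul_ar {x : AlgA k} {i : Fin 3} (he : x * e k i = x)
    (har : ∀ a, x * ar k a = 0) :
    x = ∑ a, if arrowTgt a = i then arDual k a x • ar k a else 0 := by
  have hx (j : Fin 3) : eDual k j x = 0 := by
    obtain ⟨a, rfl⟩ := exists_arrowSrc_eq j
    have h := har a
    rw [← sum_dual_smul x, add_mul, Finset.sum_mul, Finset.sum_mul] at h
    simp only [smul_mul_assoc, e_mul_ar, ar_mul_ar, smul_zero, Finset.sum_const_zero,
      add_zero, smul_ite, Finset.sum_ite_eq', Finset.mem_univ, if_true] at h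
    simpa using congrArg (arDual k a) h
  conv_lhs => rw [← he, ← sum_dual_smul x]
  simp [hx, Finset.sum_mul, ar_mul_e]

section Extension

variable {E : Type} [AddCommGroup E] [Module (Aop k) E]

theorem op_mul_smul (x y : AlgA k) (z : E) :
    MulOpposite.op (x * y) • z = MulOpposite.op y • MulOpposite.op x • z := by
  rw [← mul_smul]; rfl

/-- The coordinate functional of an arrow lifts to an element supported at its source. -/
theorem exists_lift_arDual {g : E →ₗ[Aop k] DualA k} (hg : Function.Surjective g) (a : Fin 4) :
    ∃ b : E, g b = arDual k a ∧ MulOpposite.op (e k (arrowSrc a)) • b = b := by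
  obtain ⟨b, hb⟩ := hg (arDual k a)
  refine ⟨MulOpposite.op (e k (arrowSrc a)) • b, ?_, ?_⟩
  · rw [map_smul, hb, op_e_smul_arDual]
  · rw [← op_mul_smul, e_mul_e, if_pos rfl]

theorem op_e_smul_of_fixed {b : E} {i : Fin 3}
    (hb : MulOpposite.op (e k i) • b = b) (j : Fin 3) :
    MulOpposite.op (e k j) • b = if j = i then b else 0 := by
  rw [← hb, ← op_mul_smul, e_mul_e]
  split_ifs with h₁ h₂ h₂
  · rfl
  · exact absurd h₁.symm h₂
  · exact absurd h₂.symm h₁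
  · exact zero_smul _ _

theorem op_ar_smul_of_fixed {b : E} {i : Fin 3}
    (hb : MulOpposite.op (e k i) • b = b) {a : Fin 4}
    (h : i ≠ arrowSrc a) : MulOpposite.op (ar k a) • b = 0 := by
  rw [← hb, ← op_mul_smul, e_mul_ar, if_neg h]
  exact zero_smul _ _

variable [Module k E] [IsScalarTower k (Aop k) E]

/-- A map onto `D(A)` splits as soon as the coordinate functionals of the arrows lift to elements
satisfying the same relations. -/
theorem exists_section_of_lifts (g : E →ₗ[Aop k] DualA k) (b : Fin 4 → E) (u : Fin 3 → E)
    (hg : ∀ a, g (b a) = arDual k a)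
    (he : ∀ a i, MulOpposite.op (e k i) • b a = if i = arrowSrc a then b a else 0)
    (har : ∀ a c, MulOpposite.op (ar k c) • b a = if c = a then u (arrowTgt a) else 0) :
    ∃ s : DualA k →ₗ[Aop k] E, g.comp s = LinearMap.id := by
  have : SMulCommClass (Aop k) k E := IsScalarTower.to_smulCommClass'
  have hu (a) : u (arrowTgt a) = MulOpposite.op (ar k a) • b a := by rw [har, if_pos rfl]
  have hgu (i) : g (u i) = eDual k i := by
    obtain ⟨a, rfl⟩ := exists_arrowTgt_eq i
    rw [hu, map_smul, hg, op_ar_smul_arDual, if_pos rfl]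
  have heu (i j) : MulOpposite.op (e k j) • u i = if i = j then u i else 0 := by
    obtain ⟨a, rfl⟩ := exists_arrowTgt_eq i
    rw [hu, ← op_mul_smul, ar_mul_e]
    split_ifs
    · rfl
    · exact zero_smul _ _
  have haru (i c) : MulOpposite.op (ar k c) • u i = 0 := by
    obtain ⟨a, rfl⟩ := exists_arrowTgt_eq i
    rw [hu, ← op_mul_smul, ar_mul_ar]
    exact zero_smul _ _
  let σ (φ : DualA k) : E := ∑ a, φ (ar k a) • b a + ∑ i, φ (e k i) • u i
  have σ_smul (x : AlgA k) :
      ∀ φ : DualA k, σ (MulOpposite.op x • φ) = MulOpposite.op x • σ φ := by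
    induction x using AlgA.induction with
    | algebraMap c =>
      intro φ
      have h : (MulOpposite.op (algebraMap k (AlgA k) c) : Aop k) = algebraMap k (Aop k) c := rfl
      rw [h, algebraMap_smul, algebraMap_smul]
      simp [σ, Finset.smul_sum, mul_smul]
    | e i =>
      intro φ
      simp only [σ, op_smul_dual_apply, e_mul_ar, e_mul_e, smul_add, Finset.smul_sum,
        smul_comm (MulOpposite.op (e k i) : Aop k), he, heu]
      simp [apply_ite φ]
    | ar c =>
      intro φ
      simp only [σ, op_smul_dual_apply, ar_mul_ar, ar_mul_e, smul_add, Finset.smul_sum,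
        smul_comm (MulOpposite.op (ar k c) : Aop k), har, haru]
      simp [apply_ite φ]
    | mul x y hx hy =>
      intro φ
      rw [op_mul_smul, op_mul_smul, hy, hx]
    | add x y hx hy =>
      intro φ
      have h : (MulOpposite.op (x + y) : Aop k) = MulOpposite.op x + MulOpposite.op y := rfl
      rw [h, add_smul, add_smul, ← hx, ← hy]
      simp [σ, add_smul, Finset.sum_add_distrib]
      abel
  refine ⟨{ toFun := σ, map_add' := fun φ ψ ↦ ?_, map_smul' := fun x φ ↦ σ_smul x.unop φ }, ?_⟩
  · simp [σ, add_smul, Finset.sum_add_distrib]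
    abel
  · refine LinearMap.ext fun φ ↦ ?_
    change g (σ φ) = φ
    simp only [σ, map_add, map_sum, LinearMap.map_smul_of_tower, hg, hgu]
    exact linearMap_ext (by simp) (by simp)

/-- An element of the kernel at the vertex `i` annihilated by all arrows comes from a combination
of arrows ending in `i`. -/
theorem exists_eq_sum_smul {f : AlgA k →ₗ[Aop k] E} {g : E →ₗ[Aop k] DualA k}
    (hf : Function.Injective f) (hfg : LinearMap.range f = LinearMap.ker g) {z : E} {i : Fin 3}
    (hz : g z = 0) (he : MulOpposite.op (e k i) • z = z)
    (har : ∀ a, MulOpposite.op (ar k a) • z = 0) :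
    ∃ t : Fin 4 → k, z = ∑ a, if arrowTgt a = i then t a • f (ar k a) else 0 := by
  obtain ⟨x, rfl⟩ : z ∈ LinearMap.range f := by rw [hfg]; exact hz
  have hx := eq_sum_arDual_smul_ar (x := x) (i := i)
    (hf ((f.map_smul (MulOpposite.op (e k i) : Aop k) x).trans he))
    (fun a ↦ hf (((f.map_smul (MulOpposite.op (ar k a) : Aop k) x).trans (har a)).trans
      (map_zero f).symm))
  refine ⟨fun a ↦ arDual k a x, ?_⟩
  conv_lhs => rw [hx]
  simp only [map_sum, apply_ite f, LinearMap.map_smul_of_tower, map_zero]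

theorem exists_section {f : AlgA k →ₗ[Aop k] E} {g : E →ₗ[Aop k] DualA k}
    (hf : Function.Injective f) (hg : Function.Surjective g)
    (hfg : LinearMap.range f = LinearMap.ker g) :
    ∃ s : DualA k →ₗ[Aop k] E, g.comp s = LinearMap.id := by
  have : SMulCommClass (Aop k) k E := IsScalarTower.to_smulCommClass'
  have hgf (x) : g (f x) = 0 := by
    rw [← LinearMap.mem_ker, ← hfg]
    exact ⟨x, rfl⟩
  have hsf (x y : AlgA k) : MulOpposite.op x • f y = f (y * x) := (f.map_smul _ _).symm
  have hfe (a) : MulOpposite.op (ar k a) • f (e k (arrowSrc a)) = f (ar k a) := by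
    rw [hsf, e_src_mul_ar]
  have hee (i) : MulOpposite.op (e k i) • f (e k i) = f (e k i) := by
    rw [hsf, e_mul_e, if_pos rfl]
  have hae (b : E) (a) : MulOpposite.op (e k (arrowTgt a)) • MulOpposite.op (ar k a) • b
      = MulOpposite.op (ar k a) • b := by
    rw [← op_mul_smul, ar_mul_e_tgt]
  have haa (b : E) (a c) : MulOpposite.op (ar k c) • MulOpposite.op (ar k a) • b = 0 := by
    rw [← op_mul_smul, ar_mul_ar]
    exact zero_smul _ _
  choose b hgb heb using exists_lift_arDual hg
  obtain ⟨t₁, ht₁⟩ := exists_eq_sum_smul hf hfg (z := MulOpposite.op (ar k 2) • b 1) (i := 2)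
    (by rw [map_smul, hgb, op_ar_smul_arDual, if_neg (by decide)]) (hae _ 2) (haa _ _)
  obtain ⟨t₂, ht₂⟩ := exists_eq_sum_smul hf hfg (z := MulOpposite.op (ar k 1) • b 2) (i := 0)
    (by rw [map_smul, hgb, op_ar_smul_arDual, if_neg (by decide)]) (hae _ 1) (haa _ _)
  obtain ⟨t, ht⟩ := exists_eq_sum_smul hf hfg
    (z := MulOpposite.op (ar k 0) • b 0 - MulOpposite.op (ar k 3) • b 3) (i := 1)
    (by
      rw [map_sub, map_smul, map_smul, hgb, hgb, op_ar_smul_arDual, op_ar_smul_arDual,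
        if_pos rfl, if_pos rfl]
      exact sub_self _)
    (by rw [smul_sub]; exact congrArg₂ _ (hae _ 0) (hae _ 3))
    (fun a ↦ by rw [smul_sub, haa, haa, sub_zero])
  simp only [Fin.sum_univ_four, arrowTgt, Matrix.cons_val, Fin.reduceEq, if_true, if_false,
    add_zero, zero_add] at ht₁ ht₂ ht
  -- Correct the lift of each arrow `a` by a multiple of `f (e (arrowSrc a))`.
  let r : Fin 4 → k := ![t 0, t₁ 2, t₂ 1, -t 3]
  let b' (a : Fin 4) : E := b a - r a • f (e k (arrowSrc a))
  have heb' (a) : MulOpposite.op (e k (arrowSrc a)) • b' a = b' a := by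
    simp only [b', smul_sub, heb, smul_comm (MulOpposite.op (e k (arrowSrc a)) : Aop k), hee]
  have hb' (a c) (h : arrowSrc c = arrowSrc a) :
      MulOpposite.op (ar k c) • b' a = MulOpposite.op (ar k c) • b a - r a • f (ar k c) := by
    simp only [b', smul_sub, smul_comm (MulOpposite.op (ar k c) : Aop k), ← h, hfe]
  refine exists_section_of_lifts g b'
    ![MulOpposite.op (ar k 1) • b' 1, MulOpposite.op (ar k 0) • b' 0,
      MulOpposite.op (ar k 2) • b' 2]
    (fun a ↦ ?_) (fun a ↦ op_e_smul_of_fixed (heb' a)) (fun a c ↦ ?_)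
  · simp only [b', map_sub, LinearMap.map_smul_of_tower, hgf, smul_zero, sub_zero, hgb]
  · by_cases h : arrowSrc a = arrowSrc c
    · have h₁₂ : MulOpposite.op (ar k 2) • b' 1 = 0 := by
        rw [hb' 1 2 rfl, ht₁]
        exact sub_self _
      have h₂₁ : MulOpposite.op (ar k 1) • b' 2 = 0 := by
        rw [hb' 2 1 rfl, ht₂]
        exact sub_self _
      have h₃₃ : MulOpposite.op (ar k 3) • b' 3 = MulOpposite.op (ar k 0) • b' 0 := by
        rw [hb' 3 3 rfl, hb' 0 0 rfl, sub_eq_iff_eq_add.1 ht]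
        simp only [r, Matrix.cons_val, neg_smul]
        abel
      fin_cases a <;> fin_cases c <;> first
        | exact absurd h (by decide)
        | exact h₁₂
        | exact h₂₁
        | exact h₃₃
        | rfl
    · rw [op_ar_smul_of_fixed (heb' a) h, if_neg (by rintro rfl; exact h rfl)]

end Extension

end AlgA

/-- `Ext¹_A(D(A), A) = 0`; equivalently, every short exact sequence of right
`A`-modules `0 → A → E → D(A) → 0` splits. -/
theorem ext_one_dualA_algA_eq_zero (k : Type) [Field k] :
    Subsingleton (ExtA k (DualA k) (AlgA k) 1) ∧
    (∀ (E : Type) [AddCommGroup E] [Module (Aop k) E]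
        (f : AlgA k →ₗ[Aop k] E) (g : E →ₗ[Aop k] DualA k),
        Function.Injective f → Function.Surjective g →
        LinearMap.range f = LinearMap.ker g →
        ∃ s : DualA k →ₗ[Aop k] E, g.comp s = LinearMap.id) := by
  have splits (E : Type) [AddCommGroup E] [Module (Aop k) E] (f : AlgA k →ₗ[Aop k] E)
      (g : E →ₗ[Aop k] DualA k) (hf : Function.Injective f) (hg : Function.Surjective g)
      (hfg : LinearMap.range f = LinearMap.ker g) :
      ∃ s : DualA k →ₗ[Aop k] E, g.comp s = LinearMap.id := by
    let : Module k E := Module.compHom E (algebraMap k (Aop k))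
    have : IsScalarTower k (Aop k) E := IsScalarTower.of_algebraMap_smul fun _ _ ↦ rfl
    exact AlgA.exists_section hf hg hfg
  exact ⟨subsingleton_ext_one_of_forall_splits (ModuleCat.of (Aop k) (DualA k))
    (ModuleCat.of (Aop k) (AlgA k)) splits, splits⟩
end

section
/- For every n ≥ 0, the n-th syzygy of S₂ is semisimple and is given by Ωⁿ(S₂) ≅ S₁^{⊕ 2^{(n−1)/2}} ⊕ S₃^{⊕ 2^{(n−1)/2}} if n is odd, and Ωⁿ(S₂) ≅ S₂^{⊕ 2^{n/2}} if n is even. -/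
/-!
We formalize statements about the algebra `A = kQ/J²`, where `Q` is the quiver
`1 ⇄ 2 ⇄ 3` and `J` is the arrow ideal of the path algebra `kQ`.
The algebra `A` is presented by generators and relations as a quotient of the
free algebra on three vertex idempotents and four arrows.
Right `A`-modules are treated as left modules over `Aᵐᵒᵖ`.
-/

open CategoryTheory Opposite

/-- The data `(P, ε, d)` is a minimal projective resolution
`⋯ → P 1 → P 0 → N → 0` of the right `A`-module `N`: all the `P n` are projective,
the complex is exact, and all the kernels are superfluous submodules (i.e. each
induced map onto a syzygy is a projective cover). -/
def IsMinimalProjRes (k : Type) [Field k] {N : Type} [AddCommGroup N] [Module (Aop k) N]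
    (P : ℕ → Type) [∀ n, AddCommGroup (P n)] [∀ n, Module (Aop k) (P n)]
    (ε : P 0 →ₗ[Aop k] N) (d : ∀ n, P (n + 1) →ₗ[Aop k] P n) : Prop :=
  (∀ n, Module.Projective (Aop k) (P n)) ∧
  Function.Surjective ε ∧
  LinearMap.range (d 0) = LinearMap.ker ε ∧
  (∀ n, LinearMap.range (d (n + 1)) = LinearMap.ker (d n)) ∧
  (∀ K : Submodule (Aop k) (P 0), K ⊔ LinearMap.ker ε = ⊤ → K = ⊤) ∧
  (∀ n, ∀ K : Submodule (Aop k) (P (n + 1)), K ⊔ LinearMap.ker (d n) = ⊤ → K = ⊤)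

namespace AlgA

variable (k : Type) [Field k]

/-- The image in `A` of a generator of the path algebra. -/
noncomputable def gen (g : QGen) : AlgA k :=
  RingQuot.mkAlgHom k (ARel k) (FreeAlgebra.ι k g)

lemma gen_e_mul_gen_e (i j : Fin 3) :
    gen k (.e i) * gen k (.e j) = if i = j then gen k (.e i) else 0 := by
  have h := RingQuot.mkAlgHom_rel k (ARel.idem (k := k) i j)
  rw [map_mul, apply_ite (RingQuot.mkAlgHom k (ARel k)), map_zero] at h
  exact h

lemma gen_e_mul_gen_ar (j : Fin 3) (a : Fin 4) :
    gen k (.e j) * gen k (.ar a) = if j = arrowSrc a then gen k (.ar a) else 0 := by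
  have h : gen k (.e (arrowSrc a)) * gen k (.ar a) = gen k (.ar a) := by
    simpa only [map_mul] using! RingQuot.mkAlgHom_rel k (ARel.src (k := k) a)
  rw [← h, ← mul_assoc, gen_e_mul_gen_e]
  split_ifs with hj
  · rw [hj]
  · exact zero_mul _

lemma gen_ar_mul_gen_e (a : Fin 4) (j : Fin 3) :
    gen k (.ar a) * gen k (.e j) = if arrowTgt a = j then gen k (.ar a) else 0 := by
  have h : gen k (.ar a) * gen k (.e (arrowTgt a)) = gen k (.ar a) := by
    simpa only [map_mul] using! RingQuot.mkAlgHom_rel k (ARel.tgt (k := k) a)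
  rw [← h, mul_assoc, gen_e_mul_gen_e]
  split_ifs with hj
  · rfl
  · exact mul_zero _

lemma gen_ar_mul_gen_ar (a b : Fin 4) : gen k (.ar a) * gen k (.ar b) = 0 := by
  simpa only [map_mul, map_zero] using! RingQuot.mkAlgHom_rel k (ARel.radsq (k := k) a b)

variable {k}

lemma induction_gen {p : AlgA k → Prop} (x : AlgA k)
    (algebraMap : ∀ c : k, p (algebraMap k (AlgA k) c)) (gen : ∀ g, p (gen k g))
    (mul : ∀ x y, p x → p y → p (x * y)) (add : ∀ x y, p x → p y → p (x + y)) : p x := by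
  obtain ⟨x, rfl⟩ := RingQuot.mkAlgHom_surjective k (ARel k) x
  induction x using FreeAlgebra.induction with
  | grade0 r => simpa only [AlgHom.commutes] using algebraMap r
  | grade1 g => exact gen g
  | mul x y hx hy => simpa only [map_mul] using mul _ _ hx hy
  | add x y hx hy => simpa only [map_add] using add _ _ hx hy

/-- An additive map between right `A`-modules that commutes with scalars and with the
generators of `A` is `A`-linear. -/
def linearMapOfGen {M N : Type} [AddCommGroup M] [Module (Aop k) M] [AddCommGroup N]
    [Module (Aop k) N] (f : M →+ N)
    (hc : ∀ (c : k) m, f (MulOpposite.op (algebraMap k (AlgA k) c) • m) =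
      MulOpposite.op (algebraMap k (AlgA k) c) • f m)
    (hg : ∀ g m, f (MulOpposite.op (gen k g) • m) = MulOpposite.op (gen k g) • f m) :
    M →ₗ[Aop k] N where
  __ := f
  map_smul' x m := by
    suffices h : ∀ y : AlgA k, ∀ m, f (MulOpposite.op y • m) = MulOpposite.op y • f m from
      h x.unop m
    intro y
    induction y using induction_gen with
    | algebraMap c => exact hc c
    | gen g => exact hg g
    | mul x y hx hy => intro m; rw [MulOpposite.op_mul, mul_smul, mul_smul, hy, hx]
    | add x y hx hy =>
      intro m; rw [MulOpposite.op_add, add_smul, add_smul, map_add, hx, hy]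

end AlgA

namespace SimpleS

variable {k : Type} [Field k] {i : Fin 3}

lemma op_algebraMap_smul (c : k) (x : SimpleS k i) :
    MulOpposite.op (algebraMap k (AlgA k) c) • x = c • x :=
  congrArg (· * (show k from x)) ((simpleAlgHom k i).commutes c)

lemma op_gen_smul (g : QGen) (x : SimpleS k i) :
    MulOpposite.op (AlgA.gen k g) • x =
      (match g with | .e j => if j = i then (1 : k) else 0 | .ar _ => 0 : k) • x := by
  refine congrArg (· * (show k from x)) ?_
  change RingQuot.liftAlgHom k _ (RingQuot.mkAlgHom k (ARel k) _) = _
  rw [RingQuot.liftAlgHom_mkAlgHom_apply, FreeAlgebra.lift_ι_apply]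

lemma op_gen_e_smul (j : Fin 3) (x : SimpleS k i) :
    MulOpposite.op (AlgA.gen k (.e j)) • x = if j = i then x else 0 := by
  rw [op_gen_smul]; split_ifs with h <;> simp [h]

lemma op_gen_ar_smul (a : Fin 4) (x : SimpleS k i) :
    MulOpposite.op (AlgA.gen k (.ar a)) • x = 0 := by
  rw [op_gen_smul]; exact zero_smul k x

instance : IsSimpleModule (Aop k) (SimpleS k i) := by
  rw [isSimpleModule_iff_toSpanSingleton_surjective]
  refine ⟨inferInstanceAs (Nontrivial k), fun x hx y => ?_⟩
  refine ⟨MulOpposite.op (algebraMap k (AlgA k)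
    ((show k from y) * (show k from x)⁻¹)), ?_⟩
  rw [LinearMap.toSpanSingleton_apply, op_algebraMap_smul]
  exact inv_mul_cancel_right₀ (G₀ := k) hx y

end SimpleS

/-- The indecomposable projective right module `e_i A`, with basis `e_i` and the arrows
starting at `i`. -/
@[ext] structure ProjT (k : Type) (i : Fin 3) : Type where
  /-- The coefficient of `e_i`. -/
  idem : k
  /-- The coefficients of the arrows. -/
  arrow : {a : Fin 4 // arrowSrc a = i} → k

namespace ProjT

variable (k : Type) [Field k] (i : Fin 3)

/-- Coordinates on `e_i A`. -/
def equiv : ProjT k i ≃ k × ({a : Fin 4 // arrowSrc a = i} → k) where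
  toFun x := (x.idem, x.arrow)
  invFun x := ⟨x.1, x.2⟩

instance : AddCommGroup (ProjT k i) := (equiv k i).addCommGroup

instance : Module k (ProjT k i) := (equiv k i).module k

@[simp] lemma idem_add (x y : ProjT k i) : (x + y).idem = x.idem + y.idem := rfl
@[simp] lemma arrow_add (x y : ProjT k i) : (x + y).arrow = x.arrow + y.arrow := rfl
@[simp] lemma idem_zero : (0 : ProjT k i).idem = 0 := rfl
@[simp] lemma arrow_zero : (0 : ProjT k i).arrow = 0 := rfl
@[simp] lemma idem_smul (c : k) (x : ProjT k i) : (c • x).idem = c * x.idem := rfl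
@[simp] lemma arrow_smul (c : k) (x : ProjT k i) : (c • x).arrow = c • x.arrow := rfl

@[simp] lemma idem_sum {ι : Type*} (s : Finset ι) (f : ι → ProjT k i) :
    (∑ j ∈ s, f j).idem = ∑ j ∈ s, (f j).idem :=
  map_sum (AddMonoidHom.mk' idem (idem_add k i)) f s

@[simp] lemma arrow_sum {ι : Type*} (s : Finset ι) (f : ι → ProjT k i) :
    (∑ j ∈ s, f j).arrow = ∑ j ∈ s, (f j).arrow :=
  map_sum (AddMonoidHom.mk' arrow (arrow_add k i)) f s

/-- Right multiplication by `e_j` on `e_i A`. -/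
@[simps] def actE (j : Fin 3) : Module.End k (ProjT k i) where
  toFun x := ⟨if i = j then x.idem else 0, fun b => if arrowTgt b.1 = j then x.arrow b else 0⟩
  map_add' x y := by ext <;> simp <;> split_ifs <;> simp
  map_smul' c x := by ext <;> simp

/-- Right multiplication by the arrow `a` on `e_i A`. -/
@[simps] def actAr (a : Fin 4) : Module.End k (ProjT k i) where
  toFun x := ⟨0, fun b => if b.1 = a then x.idem else 0⟩
  map_add' x y := by ext <;> simp; split_ifs <;> simp
  map_smul' c x := by ext <;> simp

/-- The right action of `A` on `e_i A`. -/
noncomputable def act : AlgA k →ₐ[k] (Module.End k (ProjT k i))ᵐᵒᵖ :=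
  RingQuot.liftAlgHom k
    ⟨FreeAlgebra.lift k (fun g => match g with
        | QGen.e j => MulOpposite.op (actE k i j)
        | QGen.ar a => MulOpposite.op (actAr k i a)), by
      intro _x _y h
      induction h with
      | idem j l =>
          rw [map_mul, apply_ite (FreeAlgebra.lift k _), map_zero]
          simp only [FreeAlgebra.lift_ι_apply]
          apply MulOpposite.unop_injective
          split_ifs with h
          · subst h; ext x b <;> simp <;> tauto
          · ext x b <;> simp <;> grind
      | sum =>
          simp only [map_add, map_one, FreeAlgebra.lift_ι_apply]
          apply MulOpposite.unop_injective
          ext x b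
          · fin_cases i <;> simp
          · simp only [MulOpposite.unop_add, MulOpposite.unop_op, LinearMap.add_apply,
              arrow_add, Pi.add_apply, actE_apply_arrow]
            generalize arrowTgt b.1 = t
            fin_cases t <;> simp
      | src a =>
          simp only [map_mul, FreeAlgebra.lift_ι_apply]
          apply MulOpposite.unop_injective
          ext x ⟨b, hb⟩
          · simp
          · simp; grind
      | tgt a =>
          simp only [map_mul, FreeAlgebra.lift_ι_apply]
          apply MulOpposite.unop_injective
          ext x b <;> simp
          grind
      | radsq a b =>
          simp only [map_mul, FreeAlgebra.lift_ι_apply, map_zero]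
          apply MulOpposite.unop_injective
          ext x b <;> simp⟩

noncomputable instance : Module (Aop k) (ProjT k i) :=
  Module.compHom (ProjT k i) (AlgHom.opComm (act k i)).toRingHom

variable {k i}

lemma op_algebraMap_smul (c : k) (x : ProjT k i) :
    MulOpposite.op (algebraMap k (AlgA k) c) • x = c • x :=
  congrArg (fun f : (Module.End k (ProjT k i))ᵐᵒᵖ => f.unop x) ((act k i).commutes c)

lemma op_gen_e_smul (j : Fin 3) (x : ProjT k i) :
    MulOpposite.op (AlgA.gen k (.e j)) • x = actE k i j x := by
  refine congrArg (fun f : (Module.End k (ProjT k i))ᵐᵒᵖ => f.unop x)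
    (?_ : act k i (AlgA.gen k _) = MulOpposite.op (actE k i j))
  rw [act, AlgA.gen, RingQuot.liftAlgHom_mkAlgHom_apply, FreeAlgebra.lift_ι_apply]

lemma op_gen_ar_smul (a : Fin 4) (x : ProjT k i) :
    MulOpposite.op (AlgA.gen k (.ar a)) • x = actAr k i a x := by
  refine congrArg (fun f : (Module.End k (ProjT k i))ᵐᵒᵖ => f.unop x)
    (?_ : act k i (AlgA.gen k _) = MulOpposite.op (actAr k i a))
  rw [act, AlgA.gen, RingQuot.liftAlgHom_mkAlgHom_apply, FreeAlgebra.lift_ι_apply]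

variable (k i)

/-- The canonical projection from `e_i A` onto its top `S_i`. -/
noncomputable def top : ProjT k i →ₗ[Aop k] SimpleS k i :=
  AlgA.linearMapOfGen { toFun := idem, map_zero' := rfl, map_add' := fun _ _ => rfl }
    (fun c m => by rw [op_algebraMap_smul, SimpleS.op_algebraMap_smul]; rfl)
    (fun g m => by
      cases g with
      | e j =>
        rw [op_gen_e_smul, SimpleS.op_gen_e_smul]
        simp only [eq_comm (a := j)]
        rfl
      | ar a => rw [op_gen_ar_smul, SimpleS.op_gen_ar_smul]; rfl)

/-- The inclusion of the radical of `e_i A`, which has one simple summand for each arrow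
starting at `i`. -/
noncomputable def rad :
    ((a : {a : Fin 4 // arrowSrc a = i}) → SimpleS k (arrowTgt a.1)) →ₗ[Aop k] ProjT k i :=
  AlgA.linearMapOfGen
    { toFun := fun f => ⟨0, f⟩
      map_zero' := rfl
      map_add' := fun _ _ => ProjT.ext (add_zero 0).symm rfl }
    (fun c m => by
      rw [op_algebraMap_smul]
      refine ProjT.ext (mul_zero c).symm (funext fun a => ?_)
      exact SimpleS.op_algebraMap_smul c (m a))
    (fun g m => by
      cases g with
      | e j =>
        rw [op_gen_e_smul]
        refine ProjT.ext (ite_self _).symm (funext fun a => ?_)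
        refine (SimpleS.op_gen_e_smul j (m a)).trans ?_
        simp only [eq_comm (a := j)]
        rfl
      | ar b =>
        rw [op_gen_ar_smul]
        refine ProjT.ext rfl (funext fun a => ?_)
        exact (SimpleS.op_gen_ar_smul b (m a)).trans (ite_self _).symm)

lemma top_surjective : Function.Surjective (top k i) := fun c => ⟨⟨c, 0⟩, rfl⟩

lemma rad_injective : Function.Injective (rad k i) := fun _ _ h => congrArg arrow h

/-- The embedding of `e_i A` into `A`. -/
noncomputable def toAop : ProjT k i →ₗ[Aop k] Aop k :=
  AlgA.linearMapOfGen
    { toFun := fun x =>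
        MulOpposite.op (x.idem • AlgA.gen k (.e i) + ∑ a, x.arrow a • AlgA.gen k (.ar a.1))
      map_zero' := by simp
      map_add' := fun x y => by
        rw [← MulOpposite.op_add]
        simp only [idem_add, arrow_add, Pi.add_apply, add_smul, Finset.sum_add_distrib]
        congr 1
        abel }
    (fun c m => by
      rw [op_algebraMap_smul, smul_eq_mul]
      refine (congrArg MulOpposite.op ?_).trans (MulOpposite.op_mul _ _)
      rw [← Algebra.commutes, ← Algebra.smul_def]
      simp [Finset.smul_sum, mul_smul])
    (fun g m => by
      rw [smul_eq_mul]
      refine (congrArg MulOpposite.op ?_).trans (MulOpposite.op_mul _ _)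
      cases g with
      | e j =>
        rw [op_gen_e_smul]
        simp only [actE_apply_idem, actE_apply_arrow, add_mul, Finset.sum_mul, smul_mul_assoc,
          AlgA.gen_e_mul_gen_e, AlgA.gen_ar_mul_gen_e, ite_smul, smul_ite, zero_smul, smul_zero]
      | ar b =>
        rw [op_gen_ar_smul]
        simp only [actAr_apply_idem, actAr_apply_arrow, add_mul, Finset.sum_mul, smul_mul_assoc,
          AlgA.gen_e_mul_gen_ar, AlgA.gen_ar_mul_gen_ar, ite_smul, smul_ite, zero_smul, smul_zero,
          Finset.sum_const_zero, add_zero, zero_add]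
        split_ifs with h
        · rw [Finset.sum_eq_single ⟨b, h.symm⟩] <;> simp +contextual [Subtype.ext_iff]
        · exact Finset.sum_eq_zero fun a _ => if_neg fun hab => h (a.2.symm.trans (congrArg arrowSrc hab)))

lemma op_smul_smul (c : k) (y : AlgA k) (x : ProjT k i) :
    MulOpposite.op (c • y) • x = c • MulOpposite.op y • x := by
  rw [← op_algebraMap_smul, ← mul_smul, ← MulOpposite.op_mul, ← Algebra.commutes,
    ← Algebra.smul_def]

instance : Module.Projective (Aop k) (ProjT k i) := by
  refine .of_split (toAop k i) (LinearMap.toSpanSingleton (Aop k) _ ⟨1, 0⟩)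
    (LinearMap.ext fun x => ?_)
  change MulOpposite.op (x.idem • AlgA.gen k (.e i) + ∑ a, x.arrow a • AlgA.gen k (.ar a.1)) •
    (⟨1, 0⟩ : ProjT k i) = x
  rw [MulOpposite.op_add, add_smul, Finset.op_sum, Finset.sum_smul]
  simp only [op_smul_smul, op_gen_e_smul, op_gen_ar_smul]
  ext b
  · simp
  · simp [← Subtype.ext_iff]

end ProjT

/-- The projective cover of a product of simple modules. -/
noncomputable def coverMap (k : Type) [Field k] {ι : Type} (v : ι → Fin 3) :
    ((j : ι) → ProjT k (v j)) →ₗ[Aop k] ((j : ι) → SimpleS k (v j)) :=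
  LinearMap.piMap fun j => ProjT.top k (v j)

section Cover

variable {k : Type} [Field k] {ι : Type} {v : ι → Fin 3}

lemma mem_ker_coverMap {x : (j : ι) → ProjT k (v j)} :
    x ∈ LinearMap.ker (coverMap k v) ↔ ∀ j, (x j).idem = 0 := funext_iff

lemma eq_top_of_sup_ker_coverMap (K : Submodule (Aop k) ((j : ι) → ProjT k (v j)))
    (hK : K ⊔ LinearMap.ker (coverMap k v) = ⊤) : K = ⊤ := by
  have arrow_smul_mem : ∀ a y, MulOpposite.op (AlgA.gen k (.ar a)) • y ∈ K := fun a y => by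
    obtain ⟨z, hz, w, hw, rfl⟩ := Submodule.mem_sup.1 (hK ▸ Submodule.mem_top : y ∈ K ⊔ _)
    have hw' : MulOpposite.op (AlgA.gen k (.ar a)) • w = 0 := by
      ext j : 1
      rw [Pi.smul_apply, ProjT.op_gen_ar_smul]
      ext <;> simp [mem_ker_coverMap.1 hw j]
    rw [smul_add, hw', add_zero]
    exact K.smul_mem _ hz
  refine top_unique (hK ▸ sup_le le_rfl fun x hx => ?_)
  have hx' : x = ∑ a : Fin 4, MulOpposite.op (AlgA.gen k (.ar a)) •
      fun j => (⟨if h : arrowSrc a = v j then (x j).arrow ⟨a, h⟩ else 0, 0⟩ : ProjT k (v j)) := by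
    ext j : 1
    rw [Finset.sum_apply]
    simp only [Pi.smul_apply, ProjT.op_gen_ar_smul]
    ext b
    · simp [mem_ker_coverMap.1 hx j]
    · simp [b.2]
  rw [hx']
  exact K.sum_mem fun a _ => arrow_smul_mem a _

/-- The kernel of the projective cover of a product of simple modules. -/
noncomputable def kerCoverMapEquiv :
    LinearMap.ker (coverMap k v) ≃ₗ[Aop k]
      ((j : ι) → (a : {a : Fin 4 // arrowSrc a = v j}) → SimpleS k (arrowTgt a.1)) :=
  (LinearEquiv.ofInjective (LinearMap.piMap fun j => ProjT.rad k (v j))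
      (fun _ _ h => funext fun j => ProjT.rad_injective k _ (congrFun h j)) ≪≫ₗ
    LinearEquiv.ofEq _ _ (by
      ext x
      refine ⟨?_, fun hx => ⟨fun j => (x j).arrow, funext fun j =>
        ProjT.ext (mem_ker_coverMap.1 hx j).symm rfl⟩⟩
      rintro ⟨f, rfl⟩
      exact mem_ker_coverMap.2 fun j => rfl)).symm

end Cover

/-- Two projective covers of the same module have isomorphic kernels. -/
lemma LinearMap.nonempty_ker_equiv_ker_of_projective {R P Q N : Type*} [Ring R]
    [AddCommGroup P] [Module R P] [AddCommGroup Q] [Module R Q] [AddCommGroup N] [Module R N]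
    [Module.Projective R P] [Module.Projective R Q] (p : P →ₗ[R] N) (q : Q →ₗ[R] N)
    (hp : Function.Surjective p) (hq : Function.Surjective q)
    (hp' : ∀ K : Submodule R P, K ⊔ ker p = ⊤ → K = ⊤)
    (hq' : ∀ K : Submodule R Q, K ⊔ ker q = ⊤ → K = ⊤) :
    Nonempty (ker p ≃ₗ[R] ker q) := by
  obtain ⟨f, hf⟩ := Module.projective_lifting_property q p hq
  have hqf : ∀ x, q (f x) = p x := LinearMap.congr_fun hf
  have hfs : Function.Surjective f := by
    refine range_eq_top.1 (hq' _ (eq_top_iff.2 fun y _ => ?_))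
    obtain ⟨x, hx⟩ := hp (q y)
    refine Submodule.mem_sup.2 ⟨f x, mem_range_self f x, y - f x, ?_, add_sub_cancel _ _⟩
    rw [mem_ker, map_sub, hqf, hx, sub_self]
  obtain ⟨s, hs⟩ := Module.projective_lifting_property f id hfs
  have hfs' : ∀ y, f (s y) = y := LinearMap.congr_fun hs
  have hss : Function.Surjective s := by
    refine range_eq_top.1 (hp' _ (eq_top_iff.2 fun x _ => ?_))
    refine Submodule.mem_sup.2 ⟨s (f x), mem_range_self s _, x - s (f x), ?_, add_sub_cancel _ _⟩
    rw [mem_ker, map_sub, ← hqf, ← hqf, hfs', sub_self]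
  let e : P ≃ₗ[R] Q := .ofLinearMap f s hs (LinearMap.ext fun x => by
    obtain ⟨y, rfl⟩ := hss x
    exact congrArg s (hfs' y))
  refine ⟨e.submoduleMap (ker p) ≪≫ₗ LinearEquiv.ofEq _ _ ?_⟩
  ext y
  refine ⟨?_, fun hy => ⟨s y, ?_, hfs' y⟩⟩
  · rintro ⟨x, hx, rfl⟩
    exact (hqf x).trans hx
  · change p (s y) = 0
    rw [← hqf, hfs']
    exact hy

/-- The kernel of a map that is a projective cover of its image, when the image is a finite
product of simple modules. -/
lemma nonempty_ker_equiv_pi {k : Type} [Field k] {ι : Type} [Finite ι] (v : ι → Fin 3)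
    {P N : Type} [AddCommGroup P] [Module (Aop k) P] [AddCommGroup N] [Module (Aop k) N]
    [Module.Projective (Aop k) P] (p : P →ₗ[Aop k] N)
    (hp' : ∀ K : Submodule (Aop k) P, K ⊔ LinearMap.ker p = ⊤ → K = ⊤)
    (e : LinearMap.range p ≃ₗ[Aop k] ((j : ι) → SimpleS k (v j))) :
    Nonempty (LinearMap.ker p ≃ₗ[Aop k]
      ((j : ι) → (a : {a : Fin 4 // arrowSrc a = v j}) → SimpleS k (arrowTgt a.1))) := by
  have : Module.Projective (Aop k) ((j : ι) → ProjT k (v j)) := by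
    classical
    have := Fintype.ofFinite ι
    exact .of_equiv DFinsupp.linearEquivFunOnFintype (R := Aop k)
  have hker : LinearMap.ker (e.toLinearMap ∘ₗ p.rangeRestrict) = LinearMap.ker p := 
    (e.ker_comp _).trans p.ker_rangeRestrict
  obtain ⟨f⟩ := LinearMap.nonempty_ker_equiv_ker_of_projective (e.toLinearMap ∘ₗ p.rangeRestrict)
    (coverMap k v) (e.surjective.comp p.surjective_rangeRestrict)
    (Function.Surjective.piMap fun j => ProjT.top_surjective k (v j))
    (by rwa [hker]) eq_top_of_sup_ker_coverMap
  exact ⟨LinearEquiv.ofEq _ _ hker.symm ≪≫ₗ f ≪≫ₗ kerCoverMapEquiv⟩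

section Arrows

variable (k : Type) [Field k]

/-- The radical of `e_1 A` is `S_2`. -/
noncomputable def radEquivZero :
    ((a : {a : Fin 4 // arrowSrc a = 0}) → SimpleS k (arrowTgt a.1)) ≃ₗ[Aop k] SimpleS k 1 :=
  .ofBijective (LinearMap.proj (⟨0, rfl⟩ : {a : Fin 4 // arrowSrc a = 0}))
    ⟨fun f g h => funext fun ⟨a, ha⟩ => by
      obtain rfl : a = 0 := by revert ha; revert a; decide
      exact h, fun x => ⟨fun _ => x, rfl⟩⟩

/-- The radical of `e_3 A` is `S_2`. -/
noncomputable def radEquivTwo :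
    ((a : {a : Fin 4 // arrowSrc a = 2}) → SimpleS k (arrowTgt a.1)) ≃ₗ[Aop k] SimpleS k 1 :=
  .ofBijective (LinearMap.proj (⟨3, rfl⟩ : {a : Fin 4 // arrowSrc a = 2}))
    ⟨fun f g h => funext fun ⟨a, ha⟩ => by
      obtain rfl : a = 3 := by revert ha; revert a; decide
      exact h, fun x => ⟨fun _ => x, rfl⟩⟩

/-- The radical of `e_2 A` is `S_1 ⊕ S_3`. -/
noncomputable def radEquivOne :
    ((a : {a : Fin 4 // arrowSrc a = 1}) → SimpleS k (arrowTgt a.1)) ≃ₗ[Aop k]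
      SimpleS k 0 × SimpleS k 2 :=
  .ofBijective ((LinearMap.proj (⟨1, rfl⟩ : {a : Fin 4 // arrowSrc a = 1})).prod
      (LinearMap.proj (⟨2, rfl⟩ : {a : Fin 4 // arrowSrc a = 1})))
    ⟨fun f g h => funext fun ⟨a, ha⟩ => by
      obtain rfl | rfl : a = 1 ∨ a = 2 := by revert ha; revert a; decide
      exacts [congrArg Prod.fst h, congrArg Prod.snd h],
    fun x => ⟨fun a => if a.1 = 1 then x.1 else x.2, rfl⟩⟩

end Arrows

/-- A power of a product of two modules is the product of the powers. -/
def LinearEquiv.piProd (R ι M N : Type*) [Semiring R] [AddCommMonoid M] [Module R M]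
    [AddCommMonoid N] [Module R N] : (ι → M × N) ≃ₗ[R] (ι → M) × (ι → N) where
  __ := Equiv.arrowProdEquivProdArrow ι (fun _ => M) (fun _ => N)
  map_add' _ _ := rfl
  map_smul' _ _ := rfl

instance isSemisimpleModule_pi_zero_prod_pi_two (k : Type) [Field k] (n : ℕ) :
    IsSemisimpleModule (Aop k) ((Fin n → SimpleS k 0) × (Fin n → SimpleS k 2)) :=
  .congr (LinearEquiv.sumPiEquivProdPi (Aop k) (Fin n) (Fin n) fun j =>
    SimpleS k (Sum.elim (fun _ => 0) (fun _ => 2) j)).symm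

section Syzygies

variable {k : Type} [Field k] {P N : Type} [AddCommGroup P] [Module (Aop k) P]
  [AddCommGroup N] [Module (Aop k) N] [Module.Projective (Aop k) P]

lemma nonempty_ker_equiv_of_equiv_two {n : ℕ} (p : P →ₗ[Aop k] N)
    (hp' : ∀ K : Submodule (Aop k) P, K ⊔ LinearMap.ker p = ⊤ → K = ⊤)
    (e : LinearMap.range p ≃ₗ[Aop k] (Fin n → SimpleS k 1)) :
    Nonempty (LinearMap.ker p ≃ₗ[Aop k] (Fin n → SimpleS k 0) × (Fin n → SimpleS k 2)) := by
  obtain ⟨f⟩ := nonempty_ker_equiv_pi (fun _ : Fin n => 1) p hp' e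
  exact ⟨f ≪≫ₗ LinearEquiv.piCongrRight (fun _ => radEquivOne k) ≪≫ₗ LinearEquiv.piProd ..⟩

lemma nonempty_ker_equiv_of_equiv_one_three {n : ℕ} (p : P →ₗ[Aop k] N)
    (hp' : ∀ K : Submodule (Aop k) P, K ⊔ LinearMap.ker p = ⊤ → K = ⊤)
    (e : LinearMap.range p ≃ₗ[Aop k] (Fin n → SimpleS k 0) × (Fin n → SimpleS k 2)) :
    Nonempty (LinearMap.ker p ≃ₗ[Aop k] (Fin (n + n) → SimpleS k 1)) := by
  let v : Fin n ⊕ Fin n → Fin 3 := Sum.elim (fun _ => 0) (fun _ => 2)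
  obtain ⟨f⟩ := nonempty_ker_equiv_pi v p hp'
    (e ≪≫ₗ (LinearEquiv.sumPiEquivProdPi (Aop k) _ _ fun j => SimpleS k (v j)).symm)
  exact ⟨f ≪≫ₗ LinearEquiv.sumPiEquivProdPi (Aop k) _ _ _ ≪≫ₗ
    (LinearEquiv.piCongrRight fun _ => radEquivZero k).prodCongr
      (LinearEquiv.piCongrRight fun _ => radEquivTwo k) ≪≫ₗ
    (LinearEquiv.sumArrowLequivProdArrow ..).symm ≪≫ₗ
    LinearEquiv.funCongrLeft (Aop k) _ finSumFinEquiv.symm⟩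

end Syzygies

/-- In a minimal projective resolution `⋯ → P 1 → P 0 → S₂ → 0` of `S₂`, every syzygy
`Ωⁿ(S₂)` is semisimple, and
`Ωⁿ(S₂) ≅ S₁^(2^((n-1)/2)) ⊕ S₃^(2^((n-1)/2))` for odd `n`, while
`Ωⁿ(S₂) ≅ S₂^(2^(n/2))` for even `n`.
Here `Ω¹(S₂) = ker ε` and `Ω^(n+2)(S₂) = ker (d n)` (the case `n = 0` being
`Ω⁰(S₂) = S₂` itself). -/
theorem syzygies_of_simple_two (k : Type) [Field k]
    (P : ℕ → Type) [∀ n, AddCommGroup (P n)] [∀ n, Module (Aop k) (P n)]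
    (ε : P 0 →ₗ[Aop k] SimpleS k 1) (d : ∀ n, P (n + 1) →ₗ[Aop k] P n)
    (hres : IsMinimalProjRes k P ε d) :
    (IsSemisimpleModule (Aop k) (LinearMap.ker ε) ∧
      ∀ n, IsSemisimpleModule (Aop k) (LinearMap.ker (d n))) ∧
    Nonempty ((LinearMap.ker ε) ≃ₗ[Aop k] (SimpleS k 0 × SimpleS k 2)) ∧
    (∀ m : ℕ, Nonempty ((LinearMap.ker (d (2 * m))) ≃ₗ[Aop k]
        (Fin (2 ^ (m + 1)) → SimpleS k 1))) ∧
    (∀ m : ℕ, Nonempty ((LinearMap.ker (d (2 * m + 1))) ≃ₗ[Aop k]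
        ((Fin (2 ^ (m + 1)) → SimpleS k 0) × (Fin (2 ^ (m + 1)) → SimpleS k 2)))) := by
  obtain ⟨hproj, hε, h0, hd, hε', hd'⟩ := hres
  obtain ⟨e₀⟩ := nonempty_ker_equiv_of_equiv_two (n := 1) ε hε'
    (LinearEquiv.ofTop _ (LinearMap.range_eq_top.2 hε) ≪≫ₗ
      (LinearEquiv.funUnique (Fin 1) (Aop k) (SimpleS k 1)).symm)
  have even_of_odd : ∀ n m, Nonempty (LinearMap.range (d n) ≃ₗ[Aop k]
      (Fin m → SimpleS k 0) × (Fin m → SimpleS k 2)) →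
      Nonempty (LinearMap.ker (d n) ≃ₗ[Aop k] (Fin (m + m) → SimpleS k 1)) :=
    fun n _ ⟨e⟩ => nonempty_ker_equiv_of_equiv_one_three (d n) (hd' n) e
  have odd_of_even : ∀ n m, Nonempty (LinearMap.range (d n) ≃ₗ[Aop k]
      (Fin m → SimpleS k 1)) → Nonempty (LinearMap.ker (d n) ≃ₗ[Aop k]
      (Fin m → SimpleS k 0) × (Fin m → SimpleS k 2)) :=
    fun n _ ⟨e⟩ => nonempty_ker_equiv_of_equiv_two (d n) (hd' n) e
  have even : ∀ m : ℕ, Nonempty ((LinearMap.ker (d (2 * m))) ≃ₗ[Aop k]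
      (Fin (2 ^ (m + 1)) → SimpleS k 1)) := by
    intro m
    induction m with
    | zero => exact even_of_odd 0 1 ⟨LinearEquiv.ofEq _ _ h0 ≪≫ₗ e₀⟩
    | succ m ih =>
      rw [← hd] at ih
      have := odd_of_even _ _ ih
      rw [← hd] at this
      rw [pow_succ, mul_two]
      exact even_of_odd _ _ this
  have odd : ∀ m : ℕ, Nonempty ((LinearMap.ker (d (2 * m + 1))) ≃ₗ[Aop k]
      ((Fin (2 ^ (m + 1)) → SimpleS k 0) × (Fin (2 ^ (m + 1)) → SimpleS k 2))) := by
    intro m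
    have := even m
    rw [← hd] at this
    exact odd_of_even _ _ this
  let e₁ := e₀ ≪≫ₗ (LinearEquiv.funUnique (Fin 1) (Aop k) (SimpleS k 0)).prodCongr
    (LinearEquiv.funUnique (Fin 1) (Aop k) (SimpleS k 2))
  refine ⟨⟨.congr e₀, fun n => ?_⟩, ⟨e₁⟩, even, odd⟩
  obtain ⟨m, rfl | rfl⟩ := n.even_or_odd'
  · exact .congr (even m).some
  · exact .congr (odd m).some
end
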